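/- arXiv:1401.2659 — 4 statements merged into one kernel-verified Lean document; each statement's English description precedes it below -/
import Mathlib

section
/- Let a ≥ b ≥ 1, c ≥ 0, d ≥ 2. Then for every m there exists n ≡ bc (mod a) with n ≥ m such that |D_{a,b}(n − a)| ≢ |D_{a,b}(n)| (mod d), where D_{a,b}(n) is the set of partitions of n into distinct parts congruent to b mod a. -/
/-- `Dab a b n`: partitions of `n` into distinct parts each congruent to `b` mod `a`. -/
def Dab (a b n : ℕ) : Finset (Nat.Partition n) :=
  Finset.univ.filter (fun P => P.parts.Nodup ∧ ∀ x ∈ P.parts, x % a = b % a)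


namespace Work

/-- Index sets of distinct-part partitions. -/
def A (a b n : ℕ) : Finset (Finset ℕ) :=
  (Finset.range (n + 1)).powerset.filter (fun s => ∑ x ∈ s, (b + a * x) = n)

def T (a b j n : ℕ) : Finset (Finset ℕ) := (A a b n).filter (fun s => s.card = j)

lemma mem_A {a b n : ℕ} (hb : 1 ≤ b) (hab : b ≤ a) (s : Finset ℕ) :
    s ∈ A a b n ↔ ∑ x ∈ s, (b + a * x) = n := by
  simp only [A, Finset.mem_filter, Finset.mem_powerset, and_iff_right_iff_imp]
  intro h x hx
  have h1 : b + a * x ≤ ∑ x ∈ s, (b + a * x) :=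
    Finset.single_le_sum (f := fun x => b + a * x) (fun _ _ => Nat.zero_le _) hx
  have : x ≤ a * x := Nat.le_mul_of_pos_left _ (by omega)
  simp only [Finset.mem_range]; omega

lemma mem_T {a b j n : ℕ} (hb : 1 ≤ b) (hab : b ≤ a) (s : Finset ℕ) :
    s ∈ T a b j n ↔ ∑ x ∈ s, (b + a * x) = n ∧ s.card = j := by
  simp [T, mem_A hb hab]

lemma card_D {a b n : ℕ} (hb : 1 ≤ b) (hab : b ≤ a) : (Dab a b n).card = (A a b n).card := by
  have key : ∀ x, 0 < x → x % a = b % a → b + a * ((x - b) / a) = x := by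
    intro x hx h
    have hbx : b ≤ x := by
      rcases Nat.lt_or_ge b a with h1 | h1
      · rw [Nat.mod_eq_of_lt h1] at h
        have := Nat.mod_le x a; omega
      · have : b = a := by omega
        subst this
        rw [Nat.mod_self] at h
        exact Nat.le_of_dvd hx (Nat.dvd_of_mod_eq_zero h)
    have : a ∣ x - b := (Nat.modEq_iff_dvd' hbx).1 h.symm
    rw [Nat.mul_div_cancel' this]; omega
  have ha : 0 < a := by omega
  have inj : Function.Injective (fun x => b + a * x) := by
    intro x y h
    have : a * x = a * y := by simpa using h
    exact Nat.eq_of_mul_eq_mul_left ha this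
  symm
  refine Finset.card_bij (fun s hs => (⟨s.val.map (fun x => b + a * x), ?_, ?_⟩ : Nat.Partition n))
    ?_ ?_ ?_
  · intro i hi
    simp only [Multiset.mem_map] at hi
    obtain ⟨x, _, rfl⟩ := hi
    omega
  · exact (mem_A hb hab s).1 hs
  · intro s hs
    simp only [Dab, Finset.mem_filter, Finset.mem_univ, true_and]
    refine ⟨Multiset.Nodup.map inj s.nodup, ?_⟩
    intro x hx
    simp only [Multiset.mem_map] at hx
    obtain ⟨y, _, rfl⟩ := hx
    simp
  · intro s hs t ht h
    have h2 := congrArg Nat.Partition.parts h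
    exact Finset.val_injective (Multiset.map_injective inj h2)
  · intro P hP
    simp only [Dab, Finset.mem_filter, Finset.mem_univ, true_and] at hP
    obtain ⟨h1, h2⟩ := hP
    have hm : (P.parts.map (fun x => (x - b) / a)).map (fun x => b + a * x) = P.parts := by
      rw [Multiset.map_map]
      conv_rhs => rw [← Multiset.map_id P.parts]
      apply Multiset.map_congr rfl
      intro x hx
      exact key x (P.parts_pos hx) (h2 x hx)
    have hnd : (P.parts.map (fun x => (x - b) / a)).Nodup := by
      apply Multiset.Nodup.of_map (fun x => b + a * x)
      rw [hm]; exact h1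
    refine ⟨⟨_, hnd⟩, ?_, ?_⟩
    · rw [mem_A hb hab]
      change (Multiset.map _ _).sum = n
      rw [hm]; exact P.parts_sum
    · apply Nat.Partition.ext
      exact hm

def sh (s : Finset ℕ) : Finset ℕ := s.map ⟨Nat.succ, Nat.succ_injective⟩

lemma sh_inj : Function.Injective sh := Finset.map_injective _

lemma zero_sh (s : Finset ℕ) : 0 ∉ sh s := by simp [sh]

lemma sum_sh (a b : ℕ) (s : Finset ℕ) :
    ∑ x ∈ sh s, (b + a * x) = ∑ x ∈ s, (b + a * x) + a * s.card := by
  simp only [sh, Finset.sum_map, Function.Embedding.coeFn_mk, Nat.succ_eq_add_one]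
  simp only [mul_add, mul_one, ← add_assoc]
  rw [Finset.sum_add_distrib (g := fun _ => a)]
  simp [mul_comm]

lemma card_sh (s : Finset ℕ) : (sh s).card = s.card := by simp [sh]

lemma exists_sh (s : Finset ℕ) (h : 0 ∉ s) : ∃ t, sh t = s := by
  refine ⟨s.image Nat.pred, ?_⟩
  ext x
  simp only [sh, Finset.mem_map, Finset.mem_image, Function.Embedding.coeFn_mk]
  constructor
  · rintro ⟨_, ⟨y, hy, rfl⟩, rfl⟩
    have : y ≠ 0 := fun h0 => h (h0 ▸ hy)
    rwa [Nat.succ_pred_eq_of_ne_zero this]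
  · intro hx
    have : x ≠ 0 := fun h0 => h (h0 ▸ hx)
    exact ⟨_, ⟨x, hx, rfl⟩, Nat.succ_pred_eq_of_ne_zero this⟩

lemma T_rec {a b : ℕ} (hb : 1 ≤ b) (hab : b ≤ a) (j n : ℕ) :
    (T a b (j + 1) n).card =
      (if a * (j + 1) ≤ n then (T a b (j + 1) (n - a * (j + 1))).card else 0) +
      (if b + a * j ≤ n then (T a b j (n - (b + a * j))).card else 0) := by
  rw [← Finset.card_filter_add_card_filter_not (s := T a b (j+1) n) (fun s => 0 ∉ s)]
  congr 1
  · split_ifs with h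
    · symm
      apply Finset.card_bij (fun s _ => sh s)
      · intro s hs
        rw [mem_T hb hab] at hs
        rw [Finset.mem_filter, mem_T hb hab, sum_sh, card_sh, hs.1, hs.2]
        exact ⟨⟨by omega, rfl⟩, zero_sh s⟩
      · intro s _ t _ h; exact sh_inj h
      · intro s hs
        rw [Finset.mem_filter, mem_T hb hab] at hs
        obtain ⟨t, rfl⟩ := exists_sh s hs.2
        refine ⟨t, ?_, rfl⟩
        rw [sum_sh, card_sh] at hs
        rw [mem_T hb hab]
        obtain ⟨⟨h1, h2⟩, _⟩ := hs
        rw [h2] at h1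
        exact ⟨by omega, h2⟩
    · rw [Finset.card_eq_zero, Finset.eq_empty_iff_forall_notMem]
      intro s hs
      rw [Finset.mem_filter, mem_T hb hab] at hs
      obtain ⟨t, rfl⟩ := exists_sh s hs.2
      rw [sum_sh, card_sh] at hs
      obtain ⟨⟨h1, h2⟩, _⟩ := hs
      rw [h2] at h1
      omega
  · have hdec : ∀ s : Finset ℕ, 0 ∈ s → ∃ t, s = insert 0 (sh t) := by
      intro s hs
      obtain ⟨t, ht⟩ := exists_sh (s.erase 0) (by simp)
      exact ⟨t, by rw [ht, Finset.insert_erase hs]⟩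
    have hsum : ∀ t : Finset ℕ, ∑ x ∈ insert 0 (sh t), (b + a * x)
        = b + (∑ x ∈ t, (b + a * x) + a * t.card) := by
      intro t
      rw [Finset.sum_insert (zero_sh t), sum_sh]; simp
    have hcard : ∀ t : Finset ℕ, (insert 0 (sh t)).card = t.card + 1 := by
      intro t
      rw [Finset.card_insert_of_notMem (zero_sh t), card_sh]
    split_ifs with h
    · symm
      apply Finset.card_bij (fun s _ => insert 0 (sh s))
      · intro s hs
        rw [mem_T hb hab] at hs
        rw [Finset.mem_filter, mem_T hb hab, hsum, hcard, hs.1, hs.2]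
        exact ⟨⟨by omega, rfl⟩, by simp⟩
      · intro s _ t _ h
        have := congrArg (fun u => Finset.erase u 0) h
        simp only [Finset.erase_insert (zero_sh _)] at this
        exact sh_inj this
      · intro s hs
        rw [Finset.mem_filter, mem_T hb hab, not_not] at hs
        obtain ⟨t, rfl⟩ := hdec s hs.2
        refine ⟨t, ?_, rfl⟩
        rw [hsum, hcard] at hs
        rw [mem_T hb hab]
        obtain ⟨⟨h1, h2⟩, _⟩ := hs
        have h2 : t.card = j := by omega
        rw [h2] at h1
        exact ⟨by omega, h2⟩
    · rw [Finset.card_eq_zero, Finset.eq_empty_iff_forall_notMem]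
      intro s hs
      rw [Finset.mem_filter, mem_T hb hab, not_not] at hs
      obtain ⟨t, rfl⟩ := hdec s hs.2
      rw [hsum, hcard] at hs
      obtain ⟨⟨h1, h2⟩, _⟩ := hs
      have h2 : t.card = j := by omega
      rw [h2] at h1
      omega

open PowerSeries

variable (R : Type) [CommRing R]

noncomputable def S (a b j : ℕ) : R⟦X⟧ := PowerSeries.mk (fun n => ((T a b j n).card : R))

def e (a b j : ℕ) : ℕ := ∑ i ∈ Finset.range j, (b + a * i)

noncomputable def Q (a j k : ℕ) : Polynomial R :=
  ∏ i ∈ Finset.Ico j k, (1 - Polynomial.X ^ (a * (i + 1)))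

lemma S_zero {a b : ℕ} (hb : 1 ≤ b) (hab : b ≤ a) : S R a b 0 = 1 := by
  ext n
  rw [S, PowerSeries.coeff_mk, PowerSeries.coeff_one]
  split_ifs with h
  · have : T a b 0 n = {∅} := by
      ext s
      rw [mem_T hb hab, Finset.card_eq_zero, Finset.mem_singleton]
      constructor
      · exact fun h => h.2
      · rintro rfl; simp [h]
    simp [this]
  · have : T a b 0 n = ∅ := by
      rw [Finset.eq_empty_iff_forall_notMem]
      intro s
      rw [mem_T hb hab, Finset.card_eq_zero]
      rintro ⟨h1, rfl⟩
      simp at h1; omega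
    simp [this]

lemma S_rec {a b : ℕ} (hb : 1 ≤ b) (hab : b ≤ a) (j : ℕ) :
    S R a b (j + 1) * (1 - X ^ (a * (j + 1))) = S R a b j * X ^ (b + a * j) := by
  rw [mul_sub, mul_one, sub_eq_iff_eq_add]
  ext n
  rw [map_add, PowerSeries.coeff_mul_X_pow', PowerSeries.coeff_mul_X_pow']
  simp only [S, PowerSeries.coeff_mk]
  rw [T_rec hb hab j n]
  push_cast
  rw [add_comm]

lemma S_mul {a b : ℕ} (hb : 1 ≤ b) (hab : b ≤ a) (j : ℕ) :
    S R a b j * (Q R a 0 j : R⟦X⟧) = X ^ (e a b j) := by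
  induction j with
  | zero => simp [S_zero R hb hab, Q, e]
  | succ j ih =>
    have h1 : (Q R a 0 (j + 1) : R⟦X⟧) = (Q R a 0 j : R⟦X⟧) * (1 - X ^ (a * (j + 1))) := by
      rw [Q, Finset.prod_Ico_succ_top (Nat.zero_le _)]
      simp [Q]
    rw [h1, e, Finset.sum_range_succ, pow_add]
    change _ = X ^ (e a b j) * _
    rw [← ih]
    linear_combination (Q R a 0 j : R⟦X⟧) * S_rec R hb hab j

lemma one_sub_unit (k : ℕ) (hk : 0 < k) :
    ∃ u : R⟦X⟧, (1 - X ^ k) * u = 1 ∧ constantCoeff u = 1 := by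
  have h1 : constantCoeff (1 - X ^ k : R⟦X⟧) = 1 := by
    simp [hk.ne']
  have h0 : IsUnit (1 - X ^ k : R⟦X⟧) := by
    rw [PowerSeries.isUnit_iff_constantCoeff, h1]; exact isUnit_one
  obtain ⟨u, hu⟩ := h0.exists_right_inv
  refine ⟨u, hu, ?_⟩
  have := congrArg constantCoeff hu
  rwa [map_mul, h1, one_mul, map_one] at this

lemma e_eq (a b K : ℕ) : e a b (K + 1) = (K + 1) * b + ∑ i ∈ Finset.range K, a * (i + 1) := by
  rw [e, Finset.sum_add_distrib, Finset.sum_range_succ' (fun i => a * i)]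
  simp

/-- top term -/
lemma S_top {a b : ℕ} (hb : 1 ≤ b) (hab : b ≤ a) (K : ℕ) :
    PowerSeries.coeff (e a b (K + 1)) (S R a b (K + 1) * (Q R a 0 K : R⟦X⟧)) = 1 := by
  obtain ⟨u, hu, hc⟩ := one_sub_unit R (a * (K + 1)) (Nat.mul_pos (by omega) (by omega))
  have h1 : S R a b (K + 1) * (Q R a 0 K : R⟦X⟧) = u * X ^ (e a b (K + 1)) := by
    have h2 := S_rec R hb hab K
    have h3 := S_mul R hb hab K
    rw [show e a b (K + 1) = e a b K + (b + a * K) by rw [e, Finset.sum_range_succ]; rfl, pow_add,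
      ← h3]
    linear_combination (Q R a 0 K : R⟦X⟧) * u * h2 - S R a b (K + 1) * (Q R a 0 K : R⟦X⟧) * hu
  rw [h1, PowerSeries.coeff_mul_X_pow']
  simp [hc]

lemma Q_deg (a j K : ℕ) : (Q R a j K).natDegree ≤ ∑ i ∈ Finset.Ico j K, a * (i + 1) := by
  rw [Q]
  refine (Polynomial.natDegree_prod_le _ _).trans (Finset.sum_le_sum fun i _ => ?_)
  refine (Polynomial.natDegree_sub_le _ _).trans ?_
  simp only [Polynomial.natDegree_one, zero_le, sup_of_le_right]
  exact Polynomial.natDegree_X_pow_le _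

lemma S_low {a b : ℕ} (hb : 1 ≤ b) (hab : b ≤ a) (j K : ℕ) (hj : j ≤ K) :
    PowerSeries.coeff (e a b (K + 1)) (S R a b j * (Q R a 0 K : R⟦X⟧)) = 0 := by
  have h1 : S R a b j * (Q R a 0 K : R⟦X⟧)
      = ((Polynomial.X ^ (e a b j) * Q R a j K : Polynomial R) : R⟦X⟧) := by
    have : Q R a 0 K = Q R a 0 j * Q R a j K := by
      rw [Q, Q, Q, Finset.prod_Ico_consecutive _ (Nat.zero_le _) hj]
    rw [this, Polynomial.coe_mul, Polynomial.coe_mul, ← mul_assoc, S_mul R hb hab]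
    simp
  rw [h1, Polynomial.coeff_coe]
  apply Polynomial.coeff_eq_zero_of_natDegree_lt
  refine lt_of_le_of_lt Polynomial.natDegree_mul_le ?_
  have h2 := Q_deg R a j K
  have h3 : (Polynomial.X ^ (e a b j) : Polynomial R).natDegree ≤ e a b j :=
    Polynomial.natDegree_X_pow_le _
  have h4 : e a b j ≤ ∑ i ∈ Finset.range j, a * (i + 1) := by
    apply Finset.sum_le_sum
    intro i _
    rw [mul_add]; omega
  have h5 := Finset.sum_range_add_sum_Ico (fun i => a * (i + 1)) hj
  have h6 := e_eq a b K
  have h7 : 0 < (K + 1) * b := by positivity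
  omega

lemma T_min {a b : ℕ} (hb : 1 ≤ b) (hab : b ≤ a) (j n : ℕ) (h : n < e a b j) :
    T a b j n = ∅ := by
  have h1 : (X : ℤ⟦X⟧) ^ (e a b j) ∣ S ℤ a b j := by
    have h2 : IsUnit (Q ℤ a 0 j : ℤ⟦X⟧) := by
      rw [PowerSeries.isUnit_iff_constantCoeff]
      have : constantCoeff (Q ℤ a 0 j : ℤ⟦X⟧) = 1 := by
        rw [Polynomial.constantCoeff_coe, Q, Polynomial.coeff_zero_eq_eval_zero,
          Polynomial.eval_prod]
        apply Finset.prod_eq_one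
        intro i _
        have : a ≠ 0 := by omega
        simp [this]
      rw [this]; exact isUnit_one
    obtain ⟨u, hu⟩ := h2.exists_right_inv
    refine ⟨u, ?_⟩
    rw [← S_mul ℤ hb hab, mul_assoc, hu, mul_one]
  have := PowerSeries.X_pow_dvd_iff.1 h1 n h
  rw [S, PowerSeries.coeff_mk] at this
  exact Finset.card_eq_zero.1 (by exact_mod_cast this)

lemma T_mod {a b : ℕ} (hb : 1 ≤ b) (hab : b ≤ a) (j n : ℕ) (h : (T a b j n).Nonempty) :
    n % a = (b * j) % a := by
  obtain ⟨s, hs⟩ := h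
  rw [mem_T hb hab] at hs
  rw [← hs.1, ← hs.2, Finset.sum_add_distrib, ← Finset.mul_sum]
  simp [mul_comm]

lemma e_mono (a b : ℕ) {j k : ℕ} (h : j ≤ k) : e a b j ≤ e a b k :=
  Finset.sum_le_sum_of_subset (Finset.range_mono h)

lemma A_card {a b : ℕ} (hb : 1 ≤ b) (hab : b ≤ a) (c K n : ℕ) (hn : n ≤ e a b (K + 1))
    (hc : n % a = (b * c) % a) :
    (A a b n).card = ∑ j ∈ (Finset.range (K + 2)).filter (fun j => (b * j) % a = (b * c) % a),
      (T a b j n).card := by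
  apply Finset.card_eq_sum_card_fiberwise
  intro s hs
  have hs : s ∈ A a b n := hs
  have hT : s ∈ T a b s.card n := by simp [T, hs]
  simp only [Finset.coe_filter, Set.mem_ofPred_eq, Finset.mem_range]
  constructor
  · by_contra hlt
    have h1 : e a b (K + 2) ≤ e a b s.card := e_mono a b (by omega)
    have h2 : e a b (K + 2) = e a b (K + 1) + (b + a * (K + 1)) := by
      rw [e, Finset.sum_range_succ]; rfl
    rw [T_min hb hab _ _ (by omega)] at hT
    simp at hT
  · rw [← T_mod hb hab _ _ ⟨s, hT⟩, hc]

end Work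

open Work PowerSeries in
/-- For every `m` there is `n ≥ m` with `n ≡ bc (mod a)` such that
`|D_{a,b}(n - a)| ≢ |D_{a,b}(n)| (mod d)`. -/
theorem stmt9 (a b c d : ℕ) (hb : 1 ≤ b) (hab : b ≤ a) (hd : 2 ≤ d) :
    ∀ m : ℕ, ∃ n : ℕ, m ≤ n ∧ n % a = (b * c) % a ∧
      ¬ (Dab a b (n - a)).card ≡ (Dab a b n).card [MOD d] := by
  intro m
  by_contra! hcon
  have : Fact (1 < d) := ⟨hd⟩
  obtain ⟨K, hK⟩ : ∃ K, K + 1 = c + a * (m + a + 1) :=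
    ⟨c + a * (m + a + 1) - 1, Nat.sub_add_cancel
      (le_trans (Nat.mul_pos (by omega) (by omega)) (Nat.le_add_left _ _))⟩
  have hKm : m + a + 1 ≤ K + 1 := by
    have : m + a + 1 ≤ a * (m + a + 1) := Nat.le_mul_of_pos_left _ (by omega)
    omega
  set E := e a b (K + 1) with hE
  let G : (ZMod d)⟦X⟧ := PowerSeries.mk fun n =>
    if n % a = (b * c) % a then ((Dab a b n).card : ZMod d) else 0
  have hpoly : G * (1 - X ^ a) = ((PowerSeries.trunc (m + a) (G * (1 - X ^ a)) :
      Polynomial (ZMod d)) : (ZMod d)⟦X⟧) := by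
    ext n
    rw [Polynomial.coeff_coe, PowerSeries.coeff_trunc]
    split_ifs with h
    · rfl
    · rw [mul_sub, mul_one, map_sub, PowerSeries.coeff_mul_X_pow', if_pos (by omega)]
      simp only [G, PowerSeries.coeff_mk]
      rw [← Nat.mod_eq_sub_mod (by omega)]
      split_ifs with h2
      · rw [sub_eq_zero]
        exact ((ZMod.natCast_eq_natCast_iff _ _ _).2 (hcon n (by omega) h2)).symm
      · simp
  have hz : PowerSeries.coeff E (G * (Q (ZMod d) a 0 K : (ZMod d)⟦X⟧)) = 0 := by
    have hQ : Q (ZMod d) a 0 K = (1 - Polynomial.X ^ a) * Q (ZMod d) a 1 K := by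
      rw [Q, Finset.prod_eq_prod_Ico_succ_bot (by omega)]
      simp [Q]
    have h1 : G * (Q (ZMod d) a 0 K : (ZMod d)⟦X⟧) =
        ((PowerSeries.trunc (m + a) (G * (1 - X ^ a)) * Q (ZMod d) a 1 K :
          Polynomial (ZMod d)) : (ZMod d)⟦X⟧) := by
      rw [Polynomial.coe_mul, ← hpoly, hQ, Polynomial.coe_mul, ← mul_assoc]
      simp
    rw [h1, Polynomial.coeff_coe]
    apply Polynomial.coeff_eq_zero_of_natDegree_lt
    refine lt_of_le_of_lt Polynomial.natDegree_mul_le ?_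
    have h2 := Q_deg (ZMod d) a 1 K
    have h3 : (PowerSeries.trunc (m + a) (G * (1 - X ^ a))).natDegree ≤ m + a := by
      apply Polynomial.natDegree_le_of_degree_le
      exact (PowerSeries.degree_trunc_lt _ _).le
    have h5 := Finset.sum_range_add_sum_Ico (fun i => a * (i + 1)) (show 1 ≤ K by omega)
    have h6 := e_eq a b K
    have h7 : K + 1 ≤ (K + 1) * b := Nat.le_mul_of_pos_right _ hb
    omega
  let F : (ZMod d)⟦X⟧ :=
    ∑ j ∈ (Finset.range (K + 2)).filter (fun j => (b * j) % a = (b * c) % a), S (ZMod d) a b j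
  have hGF : ∀ n ≤ E, PowerSeries.coeff n G = PowerSeries.coeff n F := by
    intro n hn
    simp only [G, F, PowerSeries.coeff_mk, map_sum, S]
    split_ifs with h
    · rw [card_D hb hab, A_card hb hab c K n hn h]
      push_cast; rfl
    · symm
      apply Finset.sum_eq_zero
      intro j hj
      rw [Finset.mem_filter] at hj
      rcases Finset.eq_empty_or_nonempty (T a b j n) with h0 | h0
      · simp [h0]
      · exact absurd ((T_mod hb hab _ _ h0).trans hj.2) h
  have hone : PowerSeries.coeff E (F * (Q (ZMod d) a 0 K : (ZMod d)⟦X⟧)) = 1 := by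
    simp only [F]
    rw [Finset.sum_mul, map_sum, Finset.sum_eq_single (K + 1)]
    · exact S_top _ hb hab K
    · intro j hj hne
      rw [Finset.mem_filter, Finset.mem_range] at hj
      exact S_low _ hb hab j K (by omega)
    · intro h
      exfalso
      apply h
      rw [Finset.mem_filter, Finset.mem_range]
      refine ⟨by omega, ?_⟩
      rw [hK, mul_add, mul_left_comm]
      simp
  have hEq : PowerSeries.coeff E (G * (Q (ZMod d) a 0 K : (ZMod d)⟦X⟧))
      = PowerSeries.coeff E (F * (Q (ZMod d) a 0 K : (ZMod d)⟦X⟧)) := by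
    rw [PowerSeries.coeff_mul, PowerSeries.coeff_mul]
    apply Finset.sum_congr rfl
    intro p hp
    rw [Finset.HasAntidiagonal.mem_antidiagonal] at hp
    rw [hGF p.1 (by omega)]
  rw [hz, hone] at hEq
  exact zero_ne_one hEq
end

section
/- The number of partitions of n into distinct odd parts, as n ranges over even integers, takes each parity infinitely often: there are infinitely many even n with |D_{2,1}(n)| even, and infinitely many even n with |D_{2,1}(n)| odd. -/
open PowerSeries PowerSeries.WithPiTopology in
theorem hasProd_Dab [TopologicalSpace (ZMod 2)] [DiscreteTopology (ZMod 2)] :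
    HasProd (fun i : ℕ => if (i + 1) % 2 = 1 then (1 + X ^ (i + 1) : PowerSeries (ZMod 2)) else 1)
      (PowerSeries.mk fun n => ((Dab 2 1 n).card : ZMod 2)) := by
  convert! Nat.Partition.hasProd_genFun
    (fun i c => if i % 2 = 1 ∧ c = 1 then (1 : ZMod 2) else 0) using 1
  · ext1 i
    rw [tsum_eq_single 0]
    · by_cases h : (i + 1) % 2 = 1 <;> simp [h]
    · intro j hj
      simp [hj]
  · ext n
    simp_rw [Nat.Partition.genFun, Dab, Finset.card_filter, Finsupp.prod, Finset.prod_boole]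
    simp only [coeff_mk, Nat.cast_sum, Nat.cast_ite, Nat.cast_one, Nat.cast_zero]
    refine Finset.sum_congr rfl fun p _ => ?_
    congr 1
    simp only [Multiset.toFinsupp_support, Multiset.mem_toFinset, Multiset.toFinsupp_apply, eq_iff_iff]
    constructor
    · rintro ⟨h1, h2⟩ i hi
      exact ⟨by simpa using h2 i hi, Multiset.count_eq_one_of_mem h1 hi⟩
    · intro h
      refine ⟨Multiset.nodup_iff_count_eq_one.2 fun i hi => (h i hi).2, fun i hi => ?_⟩
      simpa using (h i hi).1

open PowerSeries PowerSeries.WithPiTopology in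
theorem hasProd_expand [TopologicalSpace (ZMod 2)] [DiscreteTopology (ZMod 2)] :
    HasProd (fun i : ℕ => if (i + 1) % 2 = 1 then 1 else (1 - X ^ (i + 1) : PowerSeries (ZMod 2)))
      (expand 2 two_ne_zero (pentagonalSeries (ZMod 2))) := by
  have hc : Continuous (expand 2 two_ne_zero : PowerSeries (ZMod 2) →ₐ[ZMod 2] _) := by
    rw [continuous_iff_continuousAt]
    intro x
    rw [ContinuousAt, tendsto_iff_coeff_tendsto]
    intro d
    simp only [coeff_expand]
    split_ifs
    · exact (continuous_coeff (ZMod 2) _).tendsto x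
    · exact tendsto_const_nhds
  have h := (hasProd_one_sub_X_pow (ZMod 2)).map (expand 2 two_ne_zero) hc
  rw [← one_mul (expand 2 two_ne_zero (pentagonalSeries (ZMod 2)))]
  apply HasProd.even_mul_odd
  · convert hasProd_one using 2 with k
    rw [if_pos (by omega)]
  · convert h using 1
    ext1 k
    rw [if_neg (by omega)]
    simp only [Function.comp_apply, map_sub, map_one, map_pow, expand_X, ← pow_mul]
    congr 2

open PowerSeries PowerSeries.WithPiTopology in
theorem key_prod :
    (PowerSeries.mk fun n => ((Dab 2 1 n).card : ZMod 2)) *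
      expand 2 two_ne_zero (pentagonalSeries (ZMod 2)) = pentagonalSeries (ZMod 2) := by
  let _ : TopologicalSpace (ZMod 2) := ⊥
  have _ : DiscreteTopology (ZMod 2) := ⟨rfl⟩
  have h := hasProd_Dab.mul hasProd_expand
  refine h.unique ?_
  convert hasProd_one_sub_X_pow (ZMod 2) using 1
  ext1 i
  split_ifs
  · have h1 : (-1 : PowerSeries (ZMod 2)) = 1 := by
      rw [← map_one (C (R := ZMod 2)), ← map_neg]; rfl
    rw [mul_one, sub_eq_add_neg, neg_eq_neg_one_mul, h1, one_mul]
  · rw [one_mul]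

open PowerSeries in
theorem key_even :
    (PowerSeries.mk fun n => ((Dab 2 1 (2 * n)).card : ZMod 2)) * pentagonalSeries (ZMod 2)
      = PowerSeries.mk fun n => (pentagonalSeries (ZMod 2)).coeff (2 * n) := by
  ext n
  rw [coeff_mk]
  conv_rhs => rw [← key_prod]
  rw [coeff_mul, coeff_mul]
  simp only [coeff_mk]
  refine Finset.sum_of_injOn (fun p => (2 * p.1, 2 * p.2)) ?_ ?_ ?_ ?_
  · rintro ⟨a, b⟩ _ ⟨c, d⟩ _ h
    simp only [Prod.mk.injEq] at h ⊢
    omega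
  · rintro ⟨a, b⟩ h
    simp at h ⊢
    omega
  · rintro ⟨a, b⟩ h h'
    simp only [Finset.HasAntidiagonal.mem_antidiagonal] at h
    rw [coeff_expand_of_not_dvd, mul_zero]
    rintro ⟨c, rfl⟩
    apply h'
    refine ⟨(n - c, c), ?_, ?_⟩
    · simp; omega
    · simp; omega
  · rintro ⟨a, b⟩ _
    simp only [coeff_expand_mul]

theorem pell (M : ℕ) : ∃ z x : ℤ, M < x ∧ M < z ∧ z ^ 2 = 2 * x ^ 2 + 7 ∧
    (x % 6 = 1 ∨ x % 6 = 5) := by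
  induction M with
  | zero => exact ⟨3, 1, by norm_num⟩
  | succ M ih =>
    obtain ⟨z, x, h1, h2, h3, h4⟩ := ih
    refine ⟨17 * z + 24 * x, 12 * z + 17 * x, by push_cast; omega, by push_cast; omega, ?_, by omega⟩
    linear_combination h3

theorem pent_sq (k : ℤ) : 24 * (pentagonal k : ℤ) + 1 = (6 * k - 1) ^ 2 := by
  linear_combination 12 * two_mul_natCast_pentagonal k

theorem sq_rigid {z y c : ℤ} (hz : |c| < z) (h : y ^ 2 = z ^ 2 + c) : c = 0 := by
  have hz0 : 0 < z := lt_of_le_of_lt (abs_nonneg c) hz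
  obtain ⟨h1, h2⟩ := abs_lt.1 hz
  have h' : |y| ^ 2 = z ^ 2 + c := by rw [sq_abs, h]
  have hy := abs_nonneg y
  rcases lt_trichotomy |y| z with h3 | h3 | h3
  · nlinarith
  · rw [h3] at h'; linarith
  · nlinarith

/-- For each `d` there is a pentagonal number, isolated by `d`, avoiding the sparse set. -/
theorem exists_good (d : ℕ) : ∃ j : ℤ,
    (∀ k m : ℕ, k ≤ d → d + pentagonal j = k + m → m ∈ Set.range pentagonal → k = d) ∧
    1 ≤ d + pentagonal j ∧
    2 * (d + pentagonal j) ∉ Set.range pentagonal ∧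
    2 * (d + pentagonal j - 1) ∉ Set.range pentagonal := by
  obtain ⟨z, x, hx, hz, hzx, hmod⟩ := pell (48 * d + 100)
  push_cast at hx hz
  obtain ⟨j, hj⟩ : ∃ j : ℤ, (6 * j - 1) ^ 2 = x ^ 2 := by
    rcases hmod with h | h
    · exact ⟨-(x / 6), by rw [← neg_sq]; congr 1; omega⟩
    · exact ⟨x / 6 + 1, by congr 1; omega⟩
  have hp := pent_sq j
  rw [hj] at hp
  have h1 : 1 ≤ d + pentagonal j := by
    by_contra hcon
    have : pentagonal j = 0 := by omega
    rw [this] at hp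
    push_cast at hp
    nlinarith
  refine ⟨j, ?_, h1, ?_, ?_⟩
  · rintro k m hk hkm ⟨l, rfl⟩
    have hl := pent_sq l
    have hkm' : (d : ℤ) + pentagonal j = k + pentagonal l := by exact_mod_cast hkm
    have := sq_rigid (z := x) (y := 6 * l - 1) (c := 24 * (d - k)) (by rw [abs_lt]; constructor <;> omega) (by linarith)
    omega
  · rintro ⟨l, hl⟩
    have hl2 := pent_sq l
    have hl' : (pentagonal l : ℤ) = 2 * (d + pentagonal j) := by exact_mod_cast hl
    have := sq_rigid (z := z) (y := 6 * l - 1) (c := 48 * d - 8) (by rw [abs_lt]; constructor <;> omega) (by linarith)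
    omega
  · rintro ⟨l, hl⟩
    have hl2 := pent_sq l
    have hl' : (pentagonal l : ℤ) = 2 * (d + pentagonal j - 1) := by omega
    have := sq_rigid (z := z) (y := 6 * l - 1) (c := 48 * d - 56) (by rw [abs_lt]; constructor <;> omega) (by linarith)
    omega

open PowerSeries in
theorem not_eventually_const (N : ℕ) (c : ZMod 2)
    (h : ∀ n ≥ N, ((Dab 2 1 (2 * n)).card : ZMod 2) = c) : False := by
  set A : PowerSeries (ZMod 2) := PowerSeries.mk fun n => ((Dab 2 1 (2 * n)).card : ZMod 2) with hA
  set E := pentagonalSeries (ZMod 2) with hE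
  have hAE := key_even
  rw [← hA, ← hE] at hAE
  set B := (1 + X) * A with hB
  have hB0 : B ≠ 0 := by
    intro h0
    have hA0 : A = 0 := by
      rcases mul_eq_zero.1 h0 with h1 | h1
      · have := congrArg (coeff 0) h1
        simp at this
      · exact h1
    have h2 := congrArg (coeff 0) hAE
    rw [hA0, zero_mul, coeff_mk, map_zero] at h2
    have h3 := (coeff_pentagonalSeries_eq_zero_iff (ZMod 2)).1 h2.symm
    exact h3 ⟨0, by simp [pentagonal_def]⟩
  have hBN : ∀ n > N, B.coeff n = 0 := by
    intro n hn
    obtain ⟨m, rfl⟩ : ∃ m, n = m + 1 := ⟨n - 1, by omega⟩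
    rw [hB, add_mul, one_mul, map_add, coeff_succ_X_mul, hA, coeff_mk, coeff_mk,
      h _ (by omega), h _ (by omega)]
    exact CharTwo.add_self_eq_zero c
  obtain ⟨d, hd, hdmax⟩ : ∃ d, B.coeff d ≠ 0 ∧ ∀ n > d, B.coeff n = 0 := by
    obtain ⟨n0, hn0⟩ := (PowerSeries.exists_coeff_ne_zero_iff_ne_zero).2 hB0
    classical
    refine ⟨Nat.findGreatest (fun n => B.coeff n ≠ 0) N, ?_, ?_⟩
    · refine Nat.findGreatest_spec (P := fun n => B.coeff n ≠ 0) (m := n0) ?_ hn0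
      by_contra hh
      exact hn0 (hBN _ (by omega))
    · intro n hn
      by_cases hnN : n ≤ N
      · simpa using Nat.findGreatest_is_greatest hn hnN
      · exact hBN _ (by omega)
  obtain ⟨j, hj1, hj2, hj3, hj4⟩ := exists_good d
  have hBE : B * E = (1 + X) * PowerSeries.mk fun n => E.coeff (2 * n) := by
    rw [hB, mul_assoc, hAE]
  have hco := congrArg (coeff (d + pentagonal j)) hBE
  have hR : coeff (d + pentagonal j) ((1 + X) * PowerSeries.mk fun n => E.coeff (2 * n)) = 0 := by
    obtain ⟨m, hm⟩ : ∃ m, d + pentagonal j = m + 1 := ⟨d + pentagonal j - 1, by omega⟩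
    rw [hm] at hj3 hj4 ⊢
    rw [add_mul, one_mul, map_add, coeff_succ_X_mul, coeff_mk, coeff_mk,
      coeff_pentagonalSeries_eq_zero _ hj3, coeff_pentagonalSeries_eq_zero _ (by simpa using hj4),
      add_zero]
  rw [hR, coeff_mul, Finset.sum_eq_single (d, pentagonal j)] at hco
  · rcases mul_eq_zero.1 hco with h1 | h1
    · exact hd h1
    · exact (coeff_pentagonalSeries_eq_zero_iff (ZMod 2)).1 h1 ⟨j, rfl⟩
  · rintro ⟨a, b⟩ hab hne
    rw [Finset.HasAntidiagonal.mem_antidiagonal] at hab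
    by_cases had : a ≤ d
    · by_cases hb : b ∈ Set.range pentagonal
      · have := hj1 a b had hab.symm hb
        exact absurd (by simp only [Prod.mk.injEq]; simp only at hab; omega) hne
      · rw [coeff_pentagonalSeries_eq_zero _ hb, mul_zero]
    · rw [hdmax a (by omega), zero_mul]
  · intro hn
    simp at hn

/-- Among even `n`, the number of partitions of `n` into distinct odd parts takes each
parity infinitely often. -/
theorem stmt11 :
    {n : ℕ | n % 2 = 0 ∧ (Dab 2 1 n).card % 2 = 0}.Infinite ∧
    {n : ℕ | n % 2 = 0 ∧ (Dab 2 1 n).card % 2 = 1}.Infinite := by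
  constructor
  · intro hfin
    obtain ⟨N, hN⟩ := hfin.bddAbove
    refine not_eventually_const (N + 1) 1 fun n hn => ?_
    have : (Dab 2 1 (2 * n)).card % 2 = 1 := by
      by_contra hh
      have := hN (show 2 * n ∈ {n : ℕ | n % 2 = 0 ∧ (Dab 2 1 n).card % 2 = 0} from
        ⟨by omega, by omega⟩)
      omega
    rw [← ZMod.natCast_mod, this, Nat.cast_one]
  · intro hfin
    obtain ⟨N, hN⟩ := hfin.bddAbove
    refine not_eventually_const (N + 1) 0 fun n hn => ?_
    have : (Dab 2 1 (2 * n)).card % 2 = 0 := by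
      by_contra hh
      have := hN (show 2 * n ∈ {n : ℕ | n % 2 = 0 ∧ (Dab 2 1 n).card % 2 = 1} from
        ⟨by omega, by omega⟩)
      omega
    rw [← ZMod.natCast_mod, this, Nat.cast_zero]
end

section
/- The number of partitions of n into distinct odd parts, as n ranges over odd integers, takes each parity infinitely often. -/
open PowerSeries

/-- Generating series of partitions into distinct odd parts, mod 2. -/
noncomputable def serF : PowerSeries (ZMod 2) := PowerSeries.mk fun n => ((Dab 2 1 n).card : ZMod 2)

noncomputable def serE : PowerSeries (ZMod 2) := pentagonalSeries (ZMod 2)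

theorem serF_genFun : serF =
    Nat.Partition.genFun (fun i c => if i % 2 = 1 ∧ c = 1 then (1 : ZMod 2) else 0) := by
  ext n
  rw [serF, coeff_mk, Nat.Partition.coeff_genFun, Dab, Finset.card_filter, Nat.cast_sum]
  refine Finset.sum_congr rfl fun p _ => ?_
  rw [Finsupp.prod, Multiset.toFinsupp_support, Finset.prod_ite_zero, Finset.prod_const_one]
  push_cast
  congr 1
  simp only [Multiset.toFinsupp_apply, Multiset.mem_toFinset, eq_iff_iff]
  constructor
  · rintro ⟨h1, h2⟩ i hi
    exact ⟨by simpa using h2 i hi, Multiset.count_eq_one_of_mem h1 hi⟩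
  · intro h
    refine ⟨?_, fun x hx => by simpa using (h x hx).1⟩
    rw [Multiset.nodup_iff_count_le_one]
    intro a
    by_cases ha : a ∈ p.parts
    · exact (h a ha).2.le
    · simp [Multiset.count_eq_zero_of_notMem ha]

theorem serE_sq_coeff_odd {n : ℕ} (h : n % 2 = 1) : coeff n (serE ^ 2) = 0 := by
  have := MvPowerSeries.map_frobenius_expand (R := ZMod 2) 2 (by norm_num) (f := serE)
  have h2 : (serE.expand 2 (by norm_num)).map (frobenius (ZMod 2) 2) = serE ^ 2 := this
  rw [← h2, coeff_map, coeff_expand_of_not_dvd _ _ _ (by omega)]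
  simp

theorem serE_sq_coeff_even (n : ℕ) : coeff (2 * n) (serE ^ 2) = coeff n serE := by
  have := MvPowerSeries.map_frobenius_expand (R := ZMod 2) 2 (by norm_num) (f := serE)
  have h2 : (serE.expand 2 (by norm_num)).map (frobenius (ZMod 2) 2) = serE ^ 2 := this
  rw [← h2, coeff_map, coeff_expand_mul]
  simp [ZMod.frobenius_zmod]

theorem even_odd_unique {M : Type*} [CommMonoid M] [TopologicalSpace M] [ContinuousMul M]
    [T2Space M] (f : ℕ → M) {a b c : M} (ha : HasProd (fun k => f (2 * k)) a)
    (hb : HasProd (fun k => f (2 * k + 1)) b) (hc : HasProd f c) : a * b = c :=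
  (ha.even_mul_odd hb).unique hc

open scoped PowerSeries.WithPiTopology in
theorem serF_mul_aux [TopologicalSpace (ZMod 2)] [DiscreteTopology (ZMod 2)] :
    serF * serE ^ 2 = serE := by
  have hE : HasProd (fun i : ℕ => (1 - X ^ (i + 1) : PowerSeries (ZMod 2))) serE :=
    WithPiTopology.hasProd_one_sub_X_pow (ZMod 2)
  have hneg : ∀ f : PowerSeries (ZMod 2), -f = f := fun f => by
    ext n; simp [ZMod.neg_eq_self_mod_two]
  have hsq : ∀ k : ℕ, (1 - X ^ (2 * k + 1 + 1) : PowerSeries (ZMod 2)) =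
      (1 - X ^ (k + 1)) * (1 - X ^ (k + 1)) := by
    intro k
    have : (X ^ (k + 1) : PowerSeries (ZMod 2)) + X ^ (k + 1) = 0 := by
      nth_rewrite 1 [← hneg (X ^ (k + 1))]
      simp
    linear_combination this + (hneg (X ^ (2 * k + 1 + 1)))
  have hE2 : HasProd (fun k : ℕ => (1 - X ^ (2 * k + 1 + 1) : PowerSeries (ZMod 2)))
      (serE ^ 2) := by
    rw [pow_two]
    have hm := hE.mul hE
    have hf : (fun i : ℕ => (1 - X ^ (i + 1) : PowerSeries (ZMod 2)) * (1 - X ^ (i + 1)))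
        = fun k => 1 - X ^ (2 * k + 1 + 1) := by
      funext k
      exact (hsq k).symm
    rw [hf] at hm
    exact hm
  have hF : HasProd (fun k : ℕ => (1 - X ^ (2 * k + 1) : PowerSeries (ZMod 2))) serF := by
    have h := Nat.Partition.hasProd_genFun
      (fun i c => if i % 2 = 1 ∧ c = 1 then (1 : ZMod 2) else 0)
    rw [← serF_genFun] at h
    have hf : (fun i : ℕ => (1 : PowerSeries (ZMod 2)) + ∑' j : ℕ,
        (if (i + 1) % 2 = 1 ∧ j + 1 = 1 then (1 : ZMod 2) else 0) • X ^ ((i + 1) * (j + 1)))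
        = fun i => if (i + 1) % 2 = 1 then 1 - X ^ (i + 1) else 1 := by
      funext i
      rw [tsum_eq_single 0 (by intro b hb; simp [hb])]
      by_cases hi : (i + 1) % 2 = 1
      · simp [hi, sub_eq_add_neg, hneg]
      · simp [hi]
    rw [hf] at h
    have h2 : Function.Injective (fun k : ℕ => 2 * k) := fun a b hab => by simpa using hab
    have h3 := (h2.hasProd_iff (by
      intro x hx
      have : ¬ (x + 1) % 2 = 1 := by
        intro h; exact hx ⟨x / 2, by simp; omega⟩
      simp [this])).2 h
    have hg : ((fun i : ℕ => if (i + 1) % 2 = 1 then (1 : PowerSeries (ZMod 2)) - X ^ (i + 1)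
        else 1) ∘ fun k : ℕ => 2 * k) = fun k => 1 - X ^ (2 * k + 1) := by
      funext k
      have : (2 * k + 1) % 2 = 1 := by omega
      simp [this]
    rw [hg] at h3
    exact h3
  exact even_odd_unique (fun i : ℕ => (1 - X ^ (i + 1) : PowerSeries (ZMod 2))) hF hE2 hE

theorem serF_mul : serF * serE ^ 2 = serE :=
  @serF_mul_aux ⊥ (@DiscreteTopology.mk _ ⊥ rfl)

/-- odd part -/
noncomputable def oddPart (f : PowerSeries (ZMod 2)) : PowerSeries (ZMod 2) :=
  PowerSeries.mk fun n => if n % 2 = 1 then coeff n f else 0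

theorem oddPart_mul : oddPart serF * serE ^ 2 = oddPart serE := by
  ext n
  rw [coeff_mul, oddPart, oddPart, coeff_mk]
  simp only [coeff_mk]
  split_ifs with h
  · conv_rhs => rw [← serF_mul, coeff_mul]
    refine Finset.sum_congr rfl fun x hx => ?_
    rw [Finset.HasAntidiagonal.mem_antidiagonal] at hx
    split_ifs with h1
    · rfl
    · rw [serE_sq_coeff_odd (by omega)]; simp
  · refine Finset.sum_eq_zero fun x hx => ?_
    rw [Finset.HasAntidiagonal.mem_antidiagonal] at hx
    split_ifs with h1
    · rw [serE_sq_coeff_odd (by omega)]; simp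
    · simp

theorem zmod2_ne {a : ZMod 2} : a ≠ 0 → a = 1 := by revert a; decide

/-- an eventually zero nonzero series times `serE ^ 2` has nonzero coefficients at
`d + m (3 m + 1)`. -/
theorem key (H : PowerSeries (ZMod 2)) (N : ℕ) (hN : ∀ n, N ≤ n → coeff n H = 0) (n0 : ℕ)
    (hn0 : coeff n0 H ≠ 0) :
    ∃ d, ∀ m : ℕ, d < m → coeff (d + m * (3 * m + 1)) (H * serE ^ 2) ≠ 0 := by
  classical
  let s := (Finset.range N).filter (fun n => coeff n H ≠ 0)
  have hs : ∀ n, coeff n H ≠ 0 → n ∈ s := fun n hn => by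
    simp only [s, Finset.mem_filter, Finset.mem_range]
    exact ⟨by by_contra h; exact hn (hN n (by omega)), hn⟩
  have hne : s.Nonempty := ⟨n0, hs _ hn0⟩
  obtain ⟨d, hd, hmax⟩ := s.exists_max_image id hne
  refine ⟨d, fun m hm => ?_⟩
  have hdH : coeff d H ≠ 0 := (Finset.mem_filter.1 hd).2
  have hpm : m * (3 * m + 1) = 2 * pentagonal (-(m : ℤ)) := by
    have := two_mul_natCast_pentagonal_neg m
    zify; linarith
  rw [coeff_mul, Finset.sum_eq_single (d, m * (3 * m + 1))]
  · refine mul_ne_zero hdH ?_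
    dsimp only
    rw [hpm, serE_sq_coeff_even, serE, Ne, coeff_pentagonalSeries_eq_zero_iff]
    simp
  · rintro ⟨i, j⟩ hij hne
    rw [Finset.HasAntidiagonal.mem_antidiagonal] at hij
    dsimp only at hij ⊢
    by_contra hc
    have hi : coeff i H ≠ 0 := left_ne_zero_of_mul hc
    have hj : coeff j (serE ^ 2) ≠ 0 := right_ne_zero_of_mul hc
    have hid : i ≤ d := hmax i (hs i hi)
    have hj2 : j % 2 = 0 := by
      by_contra h; exact hj (serE_sq_coeff_odd (by omega))
    obtain ⟨l, rfl⟩ : ∃ l, j = 2 * l := ⟨j / 2, by omega⟩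
    rw [serE_sq_coeff_even, serE, Ne, coeff_pentagonalSeries_eq_zero_iff, not_not] at hj
    obtain ⟨k, rfl⟩ := hj
    have hk := two_mul_natCast_pentagonal k
    have hlt : i < d := by
      rcases hid.lt_or_eq with h | h
      · exact h
      · exact absurd (by rw [Prod.mk.injEq]; omega) hne
    have h1 : (m : ℤ) * (3 * m + 1) < k * (3 * k - 1) := by
      rw [← hk]; exact_mod_cast (by omega)
    have h2 : k * (3 * k - 1) ≤ (m : ℤ) * (3 * m + 1) + d := by
      rw [← hk]; exact_mod_cast (by omega)
    have hm' : (d : ℤ) < m := by exact_mod_cast hm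
    have hd0 : (0 : ℤ) ≤ d := by positivity
    rcases le_or_gt k (-(m : ℤ) - 1) with h | h
    · nlinarith
    · rcases le_or_gt (m + 1 : ℤ) k with h' | h'
      · nlinarith
      · have hA : (0 : ℤ) ≤ m + k := by linarith
        have hB : (0 : ℤ) ≤ m - k := by linarith
        nlinarith [mul_nonneg hA hB]
  · intro h; exact absurd (by simp) h

theorem mod13 : ∀ d : ZMod 13, ∃ m : ZMod 13, ∀ k : ZMod 13,
    2 * (d + m * (3 * m + 1)) ≠ k * (3 * k - 1) ∧
    2 * (d + m * (3 * m + 1)) ≠ k * (3 * k - 1) + 4 := by decide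

theorem avoid (d : ℕ) : ∃ m : ℕ, d < m ∧ ∀ k : ℤ, pentagonal k ≠ d + m * (3 * m + 1) ∧
    pentagonal k + 2 ≠ d + m * (3 * m + 1) := by
  obtain ⟨m, hm⟩ := mod13 d
  refine ⟨m.val + 13 * (d + 1), by omega, fun k => ?_⟩
  have hk := congrArg (Int.cast : ℤ → ZMod 13) (two_mul_natCast_pentagonal k)
  push_cast at hk
  have h13 : (13 : ZMod 13) = 0 := rfl
  obtain ⟨h1, h2⟩ := hm k
  constructor
  · intro h
    apply h1
    have := congrArg (Nat.cast : ℕ → ZMod 13) h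
    push_cast at this
    rw [ZMod.natCast_zmod_val, h13] at this
    linear_combination hk - 2 * this
  · intro h
    apply h2
    have := congrArg (Nat.cast : ℕ → ZMod 13) h
    push_cast at this
    rw [ZMod.natCast_zmod_val, h13] at this
    linear_combination hk - 2 * this

theorem oddPart_ne {n : ℕ} (h : coeff n (oddPart serE) ≠ 0) : ∃ k, pentagonal k = n := by
  rw [oddPart, coeff_mk] at h
  split_ifs at h with h1
  · rw [serE, Ne, coeff_pentagonalSeries_eq_zero_iff, not_not] at h
    exact h
  · exact absurd rfl h

theorem serF_one : coeff 1 serF ≠ 0 := by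
  intro h0
  have h := congrArg (coeff 1) serF_mul
  have ha : Finset.HasAntidiagonal.antidiagonal 1 = {(0, 1), (1, 0)} := rfl
  rw [coeff_mul, ha, Finset.sum_insert (by decide), Finset.sum_singleton, h0,
    serE_sq_coeff_odd (by norm_num)] at h
  simp only [mul_zero, zero_mul, add_zero] at h
  have h1 := coeff_pentagonalSeries_pentagonal (ZMod 2) 1
  have hp : pentagonal 1 = 1 := rfl
  rw [hp, ← serE, ← h] at h1
  simp at h1

theorem cardF (n : ℕ) : coeff n serF = 0 ↔ (Dab 2 1 n).card % 2 = 0 := by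
  rw [serF, coeff_mk, ZMod.natCast_eq_zero_iff]; omega

/-- Among odd `n`, the number of partitions of `n` into distinct odd parts takes each
parity infinitely often. -/
theorem stmt12 :
    {n : ℕ | n % 2 = 1 ∧ (Dab 2 1 n).card % 2 = 0}.Infinite ∧
    {n : ℕ | n % 2 = 1 ∧ (Dab 2 1 n).card % 2 = 1}.Infinite := by
  have hone : coeff 1 (oddPart serF) ≠ 0 := by
    simpa [oddPart] using serF_one
  constructor
  · intro hfin
    obtain ⟨B, hB⟩ := hfin.bddAbove
    have hF : ∀ n, B < n → n % 2 = 1 → coeff n serF = 1 := fun n hn h => by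
      apply zmod2_ne
      rw [Ne, cardF]
      intro h'
      have := hB (show n ∈ _ from ⟨h, h'⟩)
      omega
    obtain ⟨d, hd⟩ := key ((1 - X ^ 2) * oddPart serF) (B + 3) (by
      intro n hn
      obtain ⟨n, rfl⟩ : ∃ l, n = l + 2 := ⟨n - 2, by omega⟩
      rw [sub_mul, one_mul, map_sub, coeff_X_pow_mul, oddPart, coeff_mk, coeff_mk]
      split_ifs with h1 h2 h2
      · rw [hF _ (by omega) h1, hF _ (by omega) h2, sub_self]
      · omega
      · omega
      · simp) 1 (by
      rw [sub_mul, one_mul, map_sub, coeff_X_pow_mul']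
      simpa using hone)
    obtain ⟨m, hm, hk⟩ := avoid d
    have h := hd m hm
    rw [mul_assoc, oddPart_mul, sub_mul, one_mul, map_sub, coeff_X_pow_mul'] at h
    apply h
    have e1 : coeff (d + m * (3 * m + 1)) (oddPart serE) = 0 := by
      by_contra hc
      obtain ⟨k, hk'⟩ := oddPart_ne hc
      exact (hk k).1 hk'
    rw [e1]
    split_ifs with h2
    · have e2 : coeff (d + m * (3 * m + 1) - 2) (oddPart serE) = 0 := by
        by_contra hc
        obtain ⟨k, hk'⟩ := oddPart_ne hc
        exact (hk k).2 (by omega)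
      rw [e2, sub_zero]
    · simp
  · intro hfin
    obtain ⟨B, hB⟩ := hfin.bddAbove
    obtain ⟨d, hd⟩ := key (oddPart serF) (B + 1) (by
      intro n hn
      rw [oddPart, coeff_mk]
      split_ifs with h1
      · rw [cardF]
        by_contra hc
        have := hB (show n ∈ _ from ⟨h1, by omega⟩)
        omega
      · rfl) 1 hone
    obtain ⟨m, hm, hk⟩ := avoid d
    have h := hd m hm
    rw [oddPart_mul] at h
    obtain ⟨k, hk'⟩ := oddPart_ne h
    exact (hk k).1 hk'
end

section
/- p(2n+1) takes each value of parity infinitely often: there are infinitely many n with p(2n+1) even and infinitely many n with p(2n+1) odd. -/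
open PowerSeries Filter Topology
open scoped PowerSeries.WithPiTopology

section Shanks
variable {R : Type*} [CommRing R] (x : R) (r : ℕ → R)

/-- Inner telescoping of Shanks' finite identity. -/
lemma shanks_inner (hr : ∀ k, r k * (1 - x ^ (2 * k + 1)) = 1 - x ^ (2 * k + 2)) (n m : ℕ)
    (hm : m ≤ n) :
    (1 - x ^ (2 * n + 1)) * ∑ s ∈ Finset.range m,
      ((∏ k ∈ Finset.Ico s (n + 1), r k) * x ^ (s * (2 * n + 3))
        - (∏ k ∈ Finset.Ico s n, r k) * x ^ (s * (2 * n + 1)))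
      = (∏ k ∈ Finset.Ico m n, r k) * (1 - x ^ (2 * m)) * x ^ (m * (2 * n + 1)) := by
  induction m with
  | zero => simp
  | succ m ih =>
    rw [Finset.sum_range_succ, mul_add, ih (by omega), Finset.prod_Ico_succ_top (by omega),
      Finset.prod_eq_prod_Ico_succ_bot (show m < n by omega)]
    have h1 := hr n
    have h2 := hr m
    have e1 : x ^ (m * (2 * n + 3)) = x ^ (m * (2 * n + 1)) * x ^ (2 * m) := by ring
    have e2 : x ^ ((m + 1) * (2 * n + 1)) = x ^ (m * (2 * n + 1)) * x ^ (2 * n + 1) := by ring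
    have e3 : x ^ (2 * n + 2) = x ^ (2 * n + 1) * x := by ring
    have e4 : x ^ (2 * (m + 1)) = x ^ (2 * m) * x * x := by ring
    have e5 : x ^ (2 * m + 1) = x ^ (2 * m) * x := by ring
    have e6 : x ^ (2 * m + 2) = x ^ (2 * m) * x * x := by ring
    rw [e3] at h1
    rw [e5, e6] at h2
    rw [e1, e2, e4]
    generalize ∏ k ∈ Finset.Ico (m + 1) n, r k = A
    generalize x ^ (m * (2 * n + 1)) = B at *
    generalize x ^ (2 * m) = y at *
    generalize x ^ (2 * n + 1) = z at *
    linear_combination (r m * A * B * y) * h1 + (A * B * z) * h2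

/-- Shanks' finite form of Gauss' triangular number identity. -/
lemma shanks (hr : ∀ k, r k * (1 - x ^ (2 * k + 1)) = 1 - x ^ (2 * k + 2))
    (hx : ∀ k, IsUnit (1 - x ^ (2 * k + 1))) (n : ℕ) :
    ∑ s ∈ Finset.range n, (∏ k ∈ Finset.Ico s n, r k) * x ^ (s * (2 * n + 1))
      = ∑ s ∈ Finset.range (2 * n), x ^ (s * (s + 1) / 2) := by
  induction n with
  | zero => simp
  | succ n ih =>
    have h := shanks_inner x r hr n n le_rfl
    rw [Finset.sum_sub_distrib, ih] at h
    rw [show 2 * (n + 1) = 2 * n + 1 + 1 by ring, Finset.sum_range_succ, Finset.sum_range_succ,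
      Finset.sum_range_succ]
    apply (hx n).mul_left_cancel
    have t1 : 2 * n * (2 * n + 1) / 2 = n * (2 * n + 1) := by
      rw [mul_assoc]; exact Nat.mul_div_cancel_left _ (by norm_num)
    have t2 : (2 * n + 1) * (2 * n + 1 + 1) / 2 = n * (2 * n + 1) + (2 * n + 1) := by
      rw [show (2 * n + 1) * (2 * n + 1 + 1) = 2 * (n * (2 * n + 1) + (2 * n + 1)) by ring]
      exact Nat.mul_div_cancel_left _ (by norm_num)
    rw [t1, t2]
    have h1 := hr n
    simp only [Finset.Ico_self, Finset.prod_empty, one_mul, Nat.Ico_succ_singleton,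
      Finset.prod_singleton] at h ⊢
    have e1 : x ^ (n * (2 * n + 1 + 1 + 1)) = x ^ (n * (2 * n + 1)) * x ^ (2 * n) := by ring
    have e3 : x ^ (2 * n + 2) = x ^ (2 * n) * x * x := by ring
    have e5 : x ^ (2 * n + 1) = x ^ (2 * n) * x := by ring
    rw [show 2 * n + 3 = 2 * n + 1 + 1 + 1 by ring] at h
    rw [pow_add x (n * (2 * n + 1)), e1]
    rw [e5] at h h1 ⊢
    rw [e3] at h1
    linear_combination h + x ^ (n * (2 * n + 1)) * x ^ (2 * n) * h1

end Shanks

namespace PartPar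

abbrev F := ZMod 2

/-- the partition generating series mod 2 -/
noncomputable def P : F⟦X⟧ := PowerSeries.mk fun n => (Fintype.card (Nat.Partition n) : F)

open Classical in
/-- the triangular theta series -/
noncomputable def psi : F⟦X⟧ :=
  PowerSeries.mk fun n => if ∃ s : ℕ, s * (s + 1) / 2 = n then 1 else 0

noncomputable def E : F⟦X⟧ := pentagonalSeries F

lemma P_mul_E : P * E = 1 := by
  let _ : TopologicalSpace F := ⊥
  have _ : DiscreteTopology F := ⟨rfl⟩
  have h := (Nat.Partition.hasProd_powerSeriesMk_card_restricted F (fun _ => True)).mul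
    (PowerSeries.WithPiTopology.hasProd_one_sub_X_pow F)
  have h2 : (fun i : ℕ => (if True then ∑' j : ℕ, (X : F⟦X⟧) ^ ((i + 1) * j) else 1) *
      (1 - X ^ (i + 1))) = fun _ => 1 := by
    funext i
    simp only [if_true, pow_mul]
    rw [PowerSeries.WithPiTopology.tsum_pow_mul_one_sub_of_constantCoeff_eq_zero (by simp)]
  rw [h2] at h
  have h3 := h.unique hasProd_one
  rw [← h3]
  simp [P, E, Nat.Partition.restricted, Finset.card_univ]

lemma isUnit_one_sub (k : ℕ) : IsUnit (1 - (X : F⟦X⟧) ^ (k + 1)) := by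
  rw [PowerSeries.isUnit_iff_constantCoeff]; simp

noncomputable def r (k : ℕ) : F⟦X⟧ :=
  (1 - (X : F⟦X⟧) ^ (2 * k + 2)) * (((isUnit_one_sub (2 * k)).unit⁻¹ : (F⟦X⟧)ˣ) : F⟦X⟧)

lemma r_mul (k : ℕ) : r k * (1 - X ^ (2 * k + 1)) = 1 - X ^ (2 * k + 2) := by
  rw [r, mul_assoc, IsUnit.val_inv_mul, mul_one]

lemma two_eq_zero' : (2 : F⟦X⟧) = 0 := by
  have : (2 : F) = 0 := by decide
  rw [← map_ofNat (PowerSeries.C (R := F)) 2, this, map_zero]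

lemma fin_prod (n : ℕ) :
    (∏ k ∈ Finset.range n, r k) * ∏ k ∈ Finset.range (2 * n), (1 - (X : F⟦X⟧) ^ (k + 1)) =
      PowerSeries.expand 4 (by norm_num) (∏ k ∈ Finset.range n, (1 - (X : F⟦X⟧) ^ (k + 1))) := by
  induction n with
  | zero => simp
  | succ n ih =>
    rw [Finset.prod_range_succ, show 2 * (n + 1) = 2 * n + 1 + 1 by ring, Finset.prod_range_succ,
      Finset.prod_range_succ, Finset.prod_range_succ, map_mul, ← ih]
    have h := r_mul n
    simp only [map_sub, map_one, map_pow, PowerSeries.expand_X]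
    have e : ((X : F⟦X⟧) ^ 4) ^ (n + 1) = (X ^ (2 * n + 2)) ^ 2 := by ring
    rw [e, show 2 * n + 1 + 1 = 2 * n + 2 by ring]
    generalize (X : F⟦X⟧) ^ (2 * n + 2) = z at *
    generalize (∏ k ∈ Finset.range n, r k) = A
    generalize (∏ k ∈ Finset.range (2 * n), (1 - (X : F⟦X⟧) ^ (k + 1))) = B
    linear_combination A * B * (1 - z) * h + A * B * (z ^ 2 - z) * two_eq_zero'

lemma tri_inj {a b : ℕ} (h : a * (a + 1) / 2 = b * (b + 1) / 2) : a = b := by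
  have ha : 2 ∣ a * (a + 1) := (Nat.even_mul_succ_self a).two_dvd
  have hb : 2 ∣ b * (b + 1) := (Nat.even_mul_succ_self b).two_dvd
  have h' : a * (a + 1) = b * (b + 1) := by omega
  rcases lt_trichotomy a b with h1 | h1 | h1
  · nlinarith
  · exact h1
  · nlinarith

lemma coeff_Q (N n : ℕ) (hn : N < n) :
    coeff N (∏ k ∈ Finset.range n, r k) = coeff N psi := by
  have h := congrArg (coeff N) (shanks (X : F⟦X⟧) r r_mul (fun k => isUnit_one_sub (2 * k)) n)
  obtain ⟨m, rfl⟩ : ∃ m, n = m + 1 := ⟨n - 1, by omega⟩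
  rw [Finset.sum_range_succ', map_add, map_sum, Finset.sum_eq_zero] at h
  · simp only [zero_mul, pow_zero, mul_one, zero_add, Nat.Ico_zero_eq_range] at h
    rw [h, map_sum, psi, coeff_mk]
    simp only [coeff_X_pow]
    split_ifs with hs
    · obtain ⟨s, hs⟩ := hs
      have hle : s ≤ N := by
        have : 2 ∣ s * (s + 1) := (Nat.even_mul_succ_self s).two_dvd
        have : s * (s + 1) = 2 * N := by omega
        nlinarith
      rw [Finset.sum_eq_single s]
      · simp [hs]
      · intro b _ hb
        rw [if_neg]
        intro hh
        exact hb (tri_inj (hh.symm.trans hs.symm))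
      · intro hh
        exact absurd (Finset.mem_range.2 (by omega)) hh
    · apply Finset.sum_eq_zero
      intro s _
      rw [if_neg]
      intro hh
      exact hs ⟨s, hh.symm⟩
  · intro s _
    rw [coeff_mul_X_pow', if_neg]
    nlinarith

lemma psi_mul_E : psi * E = PowerSeries.expand 4 (by norm_num) E := by
  let _ : TopologicalSpace F := ⊥
  have _ : DiscreteTopology F := ⟨rfl⟩
  have hE : Tendsto (fun n : ℕ => ∏ k ∈ Finset.range n, (1 - (X : F⟦X⟧) ^ (k + 1))) atTop (𝓝 E) :=
    (PowerSeries.WithPiTopology.hasProd_one_sub_X_pow F).tendsto_prod_nat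
  have hE2 := hE.comp (tendsto_id.const_mul_atTop' (show 0 < 2 by norm_num))
  have hQ : Tendsto (fun n : ℕ => ∏ k ∈ Finset.range n, r k) atTop (𝓝 psi) := by
    rw [PowerSeries.WithPiTopology.tendsto_iff_coeff_tendsto]
    intro d
    exact tendsto_atTop_of_eventually_const (i₀ := d + 1) fun i hi => coeff_Q d i hi
  have hR : Tendsto (fun n : ℕ => PowerSeries.expand 4 (by norm_num)
      (∏ k ∈ Finset.range n, (1 - (X : F⟦X⟧) ^ (k + 1)))) atTop
      (𝓝 (PowerSeries.expand 4 (by norm_num) E)) := by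
    rw [PowerSeries.WithPiTopology.tendsto_iff_coeff_tendsto] at hE ⊢
    intro d
    simp only [PowerSeries.coeff_expand]
    split_ifs
    · exact hE _
    · exact tendsto_const_nhds
  have hL := hQ.mul hE2
  refine tendsto_nhds_unique hL (hR.congr fun n => ?_)
  exact (fin_prod n).symm

lemma psi_eq : psi = PowerSeries.expand 4 (by norm_num) E * P := by
  rw [← psi_mul_E, mul_assoc, mul_comm E, P_mul_E, mul_one]

/-- indicator of four times pentagonal numbers -/
noncomputable def c (i : ℕ) : F := coeff i (PowerSeries.expand 4 (by norm_num) E)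

lemma c_pent (k : ℤ) : c (4 * pentagonal k) = 1 := by
  rw [c, PowerSeries.coeff_expand_mul, E, coeff_pentagonalSeries_pentagonal]
  rcases Int.even_or_odd k with h | h
  · simp [Int.negOnePow_even _ h]
  · simp [Int.negOnePow_odd _ h]

lemma c_ne (i : ℕ) (h : ∀ k, i ≠ 4 * pentagonal k) : c i = 0 := by
  rw [c, PowerSeries.coeff_expand]
  split_ifs with h4
  · obtain ⟨j, rfl⟩ := h4
    rw [Nat.mul_div_cancel_left _ (by norm_num)]
    apply coeff_pentagonalSeries_eq_zero
    rintro ⟨k, rfl⟩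
    exact h k rfl
  · rfl

lemma recur (m : ℕ) :
    coeff m psi = ∑ i ∈ Finset.range (m + 1), c i * (Fintype.card (Nat.Partition (m - i)) : F) := by
  rw [psi_eq, coeff_mul, Finset.Nat.sum_antidiagonal_eq_sum_range_succ_mk]
  simp [c, P]

lemma gap (k l : ℤ) (hk : 0 ≤ k) (h : l ≠ k) :
    k - 1 ≤ |(pentagonal l : ℤ) - pentagonal k| := by
  have h1 := two_mul_natCast_pentagonal k
  have h2 := two_mul_natCast_pentagonal l
  have h3 : 2 * ((pentagonal l : ℤ) - pentagonal k) = (l - k) * (3 * (l + k) - 1) := by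
    linear_combination h2 - h1
  have h4 : 2 * |(pentagonal l : ℤ) - pentagonal k| = |l - k| * |3 * (l + k) - 1| := by
    rw [← abs_mul, ← h3, abs_mul]; simp
  have h5 : 1 ≤ |l - k| := Int.one_le_abs (by omega)
  have h6 : 1 ≤ |3 * (l + k) - 1| := Int.one_le_abs (by omega)
  have h7 : 2 * k ≤ |l - k| + |3 * (l + k) - 1| + 1 := by
    rcases abs_cases (l - k) with h | h <;> rcases abs_cases (3 * (l + k) - 1) with h' | h' <;> omega
  nlinarith

lemma psi_cases (m : ℕ) : coeff m psi = 0 ∨ ∃ s : ℕ, s * (s + 1) = 2 * m := by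
  rw [psi, coeff_mk]
  split_ifs with h
  · right
    obtain ⟨s, rfl⟩ := h
    refine ⟨s, ?_⟩
    have : 2 ∣ s * (s + 1) := (Nat.even_mul_succ_self s).two_dvd
    omega
  · left; rfl

lemma psi_two (m : ℕ) (hm : 2 ≤ m) : coeff m psi = 0 ∨ coeff (m + 2) psi = 0 := by
  rcases psi_cases m with h | ⟨s, hs⟩
  · exact Or.inl h
  rcases psi_cases (m + 2) with h | ⟨t, ht⟩
  · exact Or.inr h
  exfalso
  have hst : s < t := by nlinarith
  have h2 : 2 ≤ s := by nlinarith
  have h3 : t = s + 1 ∨ s + 2 ≤ t := by omega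
  rcases h3 with rfl | h3
  · have : 2 * s = 2 := by nlinarith
    omega
  · nlinarith

lemma odd_infinite (N : ℕ)
    (h : ∀ n ≥ N, (Fintype.card (Nat.Partition (2 * n + 1)) : F) = 0) : False := by
  obtain ⟨k, hk⟩ : ∃ k : ℤ, k = 5 * N + 4 := ⟨_, rfl⟩
  have hr := recur (4 * pentagonal k + 1)
  rw [Finset.sum_eq_single (4 * pentagonal k), c_pent] at hr
  · rw [Nat.add_sub_cancel_left] at hr
    have h1 : (Fintype.card (Nat.Partition 1)) = 1 := by decide
    rw [h1] at hr
    rcases psi_cases (4 * pentagonal k + 1) with h0 | ⟨s, hs⟩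
    · rw [h0] at hr; simp at hr
    have h2 := two_mul_natCast_pentagonal k
    have h3 : (s : ℤ) * (s + 1) = 4 * (k * (3 * k - 1)) + 2 := by
      rw [← h2]; exact_mod_cast (by linarith)
    have h4 : ((2 * s + 1 : ℤ)) ^ 2 = 5 * (240 * (N : ℤ) ^ 2 + 368 * N + 142) + 3 := by
      subst hk
      linear_combination 4 * h3
    have h5 : ((2 * s + 1 : ℤ)) ^ 2 % 5 = 3 := by omega
    have h6 : (2 * s + 1 : ℤ) % 5 = 0 ∨ (2 * s + 1 : ℤ) % 5 = 1 ∨ (2 * s + 1 : ℤ) % 5 = 2 ∨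
      (2 * s + 1 : ℤ) % 5 = 3 ∨ (2 * s + 1 : ℤ) % 5 = 4 := by omega
    rcases h6 with h6 | h6 | h6 | h6 | h6 <;> simp [pow_two, Int.mul_emod, h6] at h5
  · intro b hb hne
    by_cases hp : ∃ l, b = 4 * pentagonal l
    · obtain ⟨l, rfl⟩ := hp
      have hl : l ≠ k := by rintro rfl; exact hne rfl
      have hg := gap k l (by omega) hl
      rw [Finset.mem_range] at hb
      rw [abs_of_nonpos (by omega)] at hg
      have := h (2 * (pentagonal k - pentagonal l)) (by omega)
      rw [show 4 * pentagonal k + 1 - 4 * pentagonal l =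
        2 * (2 * (pentagonal k - pentagonal l)) + 1 by omega, this, mul_zero]
    · rw [c_ne b (fun l hl => hp ⟨l, hl⟩), zero_mul]
  · intro hh
    exact absurd (Finset.mem_range.2 (by omega)) hh

lemma even_infinite (N : ℕ)
    (h : ∀ n ≥ N, (Fintype.card (Nat.Partition (2 * n + 1)) : F) = 1) : False := by
  obtain ⟨k, hk⟩ : ∃ k : ℤ, k = N + 5 := ⟨_, rfl⟩
  have hg := fun l => gap k l (by omega)
  obtain ⟨u, hu⟩ : ∃ u, u = pentagonal k := ⟨_, rfl⟩
  rw [← hu] at hg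
  have hu0 : N + 4 ≤ u := by
    have h0 := hg 0 (by omega)
    have : pentagonal 0 = 0 := by simp [pentagonal_def]
    rw [this, abs_of_nonpos (by omega)] at h0
    omega
  -- coefficients vanish near `4 u`
  have hc0 : ∀ i, i ≠ 4 * u → 4 * u < i + 4 * N + 16 → i < 4 * u + 4 * N + 16 → c i = 0 := by
    intro i h1 h2 h3
    apply c_ne
    rintro l rfl
    have hl : l ≠ k := by rintro rfl; exact h1 (by rw [hu])
    have h4 := hg l hl
    rcases abs_cases ((pentagonal l : ℤ) - u) with h' | h' <;> omega
  have key : ∀ m, m % 2 = 1 → (∀ i, m < i + 2 * N + 1 → i ≤ m → c i = 0) →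
      coeff m psi = ∑ i ∈ Finset.range (m + 1), c i := by
    intro m hm hz
    rw [recur]
    apply Finset.sum_congr rfl
    intro i hi
    rw [Finset.mem_range] at hi
    by_cases hi2 : m < i + 2 * N + 1
    · rw [hz i hi2 (by omega), zero_mul]
    · by_cases h2 : i % 2 = 0
      · have := h ((m - i) / 2) (by omega)
        rw [show 2 * ((m - i) / 2) + 1 = m - i by omega] at this
        rw [this, mul_one]
      · rw [c_ne i (fun l hl => h2 (by omega)), zero_mul]
  have hlow : ∑ i ∈ Finset.range (4 * u), c i = 0 := by
    have k1 := key (4 * u - 1) (by omega) (fun i _ _ => hc0 i (by omega) (by omega) (by omega))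
    have k2 := key (4 * u - 3) (by omega) (fun i _ _ => hc0 i (by omega) (by omega) (by omega))
    rw [show 4 * u - 1 + 1 = 4 * u by omega] at k1
    have e : ∑ i ∈ Finset.range (4 * u), c i = ∑ i ∈ Finset.range (4 * u - 3 + 1), c i := by
      rw [show 4 * u = (4 * u - 3 + 1) + 1 + 1 by omega, Finset.sum_range_succ,
        Finset.sum_range_succ]
      rw [show (4 * u - 3 + 1) + 1 + 1 = 4 * u by omega, hc0 _ (by omega) (by omega) (by omega),
        hc0 _ (by omega) (by omega) (by omega)]
      simp
    rcases psi_two (4 * u - 3) (by omega) with hp | hp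
    · rw [e, ← k2, hp]
    · rw [← k1, ← hp]; congr 2; omega
  have hhigh : ∀ t, t < 4 * N + 15 → ∑ i ∈ Finset.range (4 * u + t + 1), c i = 1 := by
    intro t
    induction t with
    | zero =>
      intro _
      rw [add_zero, Finset.sum_range_succ, hlow, hu, c_pent, zero_add]
    | succ t ih =>
      intro ht
      rw [Finset.sum_range_succ, show 4 * u + (t + 1) = 4 * u + t + 1 by ring, ih (by omega),
        hc0 _ (by omega) (by omega) (by omega), add_zero]
  have k1 := key (4 * u + (2 * N + 1)) (by omega)
    (fun i _ _ => hc0 i (by omega) (by omega) (by omega))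
  have k2 := key (4 * u + (2 * N + 1 + 2)) (by omega)
    (fun i _ _ => hc0 i (by omega) (by omega) (by omega))
  rw [hhigh _ (by omega)] at k1 k2
  rcases psi_two (4 * u + (2 * N + 1)) (by omega) with hp | hp
  · rw [hp] at k1; simp at k1
  · rw [show 4 * u + (2 * N + 1 + 2) = 4 * u + (2 * N + 1) + 2 by ring, hp] at k2; simp at k2

end PartPar

/-- `p(2n+1)` takes each value of parity infinitely often. -/
theorem stmt14 :
    {n : ℕ | Fintype.card (Nat.Partition (2 * n + 1)) % 2 = 0}.Infinite ∧
    {n : ℕ | Fintype.card (Nat.Partition (2 * n + 1)) % 2 = 1}.Infinite := by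
  constructor
  · intro hfin
    obtain ⟨B, hB⟩ := hfin.bddAbove
    refine PartPar.even_infinite (B + 1) fun n hn => ?_
    have h : ¬ Fintype.card (Nat.Partition (2 * n + 1)) % 2 = 0 := fun h => by
      have := hB h
      omega
    rw [ZMod.natCast_eq_one_iff_odd, Nat.odd_iff]
    omega
  · intro hfin
    obtain ⟨B, hB⟩ := hfin.bddAbove
    refine PartPar.odd_infinite (B + 1) fun n hn => ?_
    have h : ¬ Fintype.card (Nat.Partition (2 * n + 1)) % 2 = 1 := fun h => by
      have := hB h
      omega
    rw [ZMod.natCast_eq_zero_iff_even, Nat.even_iff]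
    omega
end
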